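/- Let n ≥ 1, let ψ ∈ 𝒮(ℝⁿ, ℂ) be a Schwartz wavelet that is admissible with constant C, i.e. ∫₀^∞ |ψ̂(aξ)|² da/a = C ∈ (0,∞) for every ξ ≠ 0, and let f ∈ 𝒮(ℝⁿ, ℂ). Assume that ∫₀^∞ ∫_{ℝⁿ} |ln|b|| · |W_ψf(a,b)|² db · da/a^{n+1} < ∞. Then the logarithmic uncertainty principle for the continuous wavelet transform holds: ∫₀^∞ ∫_{ℝⁿ} ln|b| · |W_ψf(a,b)|² db · da/a^{n+1} + (2π)ⁿ C ∫_{ℝⁿ} ln|ξ| · |f̂(ξ)|² dξ ≥ (Γ'(n/4)/Γ(n/4) + ln 2) · (2π)ⁿ C · ‖f‖₂², where Γ is the real Gamma function. -/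

import Mathlib

open MeasureTheory Real
open scoped RealInnerProductSpace ENNReal

/-- The Fourier transform on `ℝⁿ` with the normalization
`f̂(ξ) = (2π)^{-n/2} ∫ e^{-i⟨x,ξ⟩} f(x) dx`. -/
noncomputable def fourierTr {n : ℕ} (f : EuclideanSpace ℝ (Fin n) → ℂ)
    (ξ : EuclideanSpace ℝ (Fin n)) : ℂ :=
  (((2 * π) ^ (-(n : ℝ) / 2) : ℝ) : ℂ) *
    ∫ x, Complex.exp (-Complex.I * (⟪x, ξ⟫ : ℝ)) * f x

/-- The wavelet copy `ψ^{a,b}(x) = a^{-n/2} ψ((x-b)/a)`. -/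
noncomputable def waveletCopy {n : ℕ} (ψ : EuclideanSpace ℝ (Fin n) → ℂ) (a : ℝ)
    (b x : EuclideanSpace ℝ (Fin n)) : ℂ :=
  ((a ^ (-(n : ℝ) / 2) : ℝ) : ℂ) * ψ (a⁻¹ • (x - b))

/-- The continuous wavelet transform `W_ψf(a,b) = ∫ conj(ψ^{a,b}(x)) f(x) dx`. -/
noncomputable def CWT {n : ℕ} (ψ f : EuclideanSpace ℝ (Fin n) → ℂ) (a : ℝ)
    (b : EuclideanSpace ℝ (Fin n)) : ℂ :=
  ∫ x, (starRingEnd ℂ) (waveletCopy ψ a b x) * f x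

lemma lintegral_gamma {a r : ℝ} (ha : 0 < a) (hr : 0 < r) :
    ∫⁻ t in Set.Ioi (0:ℝ), ENNReal.ofReal (t ^ (a - 1) * Real.exp (-(r * t))) =
      ENNReal.ofReal (Real.Gamma a * r ^ (-a)) := by
  have h := Real.integral_rpow_mul_exp_neg_mul_Ioi ha hr
  have hpos : 0 < (1 / r) ^ a * Real.Gamma a := by
    have := Real.Gamma_pos_of_pos ha
    positivity
  have hi : Integrable (fun t : ℝ => t ^ (a - 1) * Real.exp (-(r * t)))
      (volume.restrict (Set.Ioi 0)) := by
    apply Integrable.of_integral_ne_zero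
    rw [h]; exact hpos.ne'
  rw [← ofReal_integral_eq_lintegral_ofReal hi, h, Real.rpow_neg hr.le, one_div,
    Real.inv_rpow hr.le, mul_comm]
  filter_upwards [self_mem_ae_restrict measurableSet_Ioi] with t ht
  have : (0:ℝ) < t := ht
  positivity

lemma lintegral_scale (c : ℝ) (hc : 0 < c) (F : ℝ → ℝ≥0∞) :
    ∫⁻ t in Set.Ioi (0:ℝ), F t = ∫⁻ t in Set.Ioi (0:ℝ), ENNReal.ofReal c * F (c * t) := by
  have h := lintegral_image_eq_lintegral_abs_deriv_mul (s := Set.Ioi (0:ℝ)) measurableSet_Ioi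
    (f := fun t => c * t) (f' := fun _ => c)
    (fun x _ => by simpa using ((hasDerivAt_id x).const_mul c).hasDerivWithinAt)
    (fun x _ y _ hxy => by simpa [hc.ne'] using hxy) F
  have him : Set.image (fun t => c * t) (Set.Ioi (0:ℝ)) = Set.Ioi 0 := by
    rw [Set.image_mul_left_Ioi hc, mul_zero]
  rw [him] at h
  rw [h, abs_of_pos hc]

lemma lintegral_beta {α k : ℝ} (hα : 0 < α) (hk : 0 < k) :
    ∫⁻ τ in Set.Ioi (0:ℝ), ENNReal.ofReal (τ ^ (α - 1) * (1 + τ) ^ (-(k + α))) =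
      ENNReal.ofReal (Real.Gamma α * Real.Gamma k / Real.Gamma (k + α)) := by
  have hG := Real.Gamma_pos_of_pos (add_pos hk hα)
  have hGa := Real.Gamma_pos_of_pos hα
  have hGk := Real.Gamma_pos_of_pos hk
  have h1 : ∀ τ ∈ Set.Ioi (0:ℝ), ENNReal.ofReal (τ ^ (α - 1) * (1 + τ) ^ (-(k + α))) =
      ∫⁻ s in Set.Ioi (0:ℝ), ENNReal.ofReal (1 / Real.Gamma (k + α)) *
        ENNReal.ofReal (τ ^ (α - 1) * (s ^ (k + α - 1) * Real.exp (-((1 + τ) * s)))) := by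
    intro τ hτ
    have hτ' : (0:ℝ) < τ := hτ
    rw [lintegral_const_mul _ (by fun_prop)]
    simp_rw [ENNReal.ofReal_mul (Real.rpow_nonneg hτ'.le (α - 1))]
    rw [lintegral_const_mul _ (by fun_prop), lintegral_gamma (by positivity) (by positivity),
      ← ENNReal.ofReal_mul (by positivity), ← ENNReal.ofReal_mul (by positivity),
      ← ENNReal.ofReal_mul (by positivity)]
    congr 1
    field_simp
  rw [setLIntegral_congr_fun measurableSet_Ioi h1, lintegral_lintegral_swap (by fun_prop)]
  have h2 : ∀ s ∈ Set.Ioi (0:ℝ), (∫⁻ τ in Set.Ioi (0:ℝ), ENNReal.ofReal (1 / Real.Gamma (k + α)) *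
        ENNReal.ofReal (τ ^ (α - 1) * (s ^ (k + α - 1) * Real.exp (-((1 + τ) * s))))) =
      ENNReal.ofReal (Real.Gamma α / Real.Gamma (k + α)) *
        ENNReal.ofReal (s ^ (k - 1) * Real.exp (-(1 * s))) := by
    intro s hs
    have hs' : (0:ℝ) < s := hs
    rw [lintegral_const_mul _ (by fun_prop)]
    have : ∀ τ, τ ^ (α - 1) * (s ^ (k + α - 1) * Real.exp (-((1 + τ) * s))) =
        (s ^ (k + α - 1) * Real.exp (-s)) * (τ ^ (α - 1) * Real.exp (-(s * τ))) := by
      intro τ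
      rw [show -((1 + τ) * s) = -s + -(s * τ) by ring, Real.exp_add]; ring
    simp_rw [this]
    simp_rw [ENNReal.ofReal_mul (show 0 ≤ s ^ (k + α - 1) * Real.exp (-s) by positivity)]
    rw [lintegral_const_mul _ (by fun_prop), lintegral_gamma (by positivity) (by positivity),
      ← ENNReal.ofReal_mul (by positivity), ← ENNReal.ofReal_mul (by positivity),
      ← ENNReal.ofReal_mul (by positivity)]
    congr 1
    rw [show k + α - 1 = (k - 1) + α by ring, Real.rpow_add hs', Real.rpow_neg hs'.le, one_mul]
    have := (Real.rpow_pos_of_pos hs' α).ne'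
    field_simp
  rw [setLIntegral_congr_fun measurableSet_Ioi h2, lintegral_const_mul _ (by fun_prop),
    lintegral_gamma hk one_pos, ← ENNReal.ofReal_mul (by positivity)]
  congr 1
  simp; ring

lemma lintegral_gauss {n : ℕ} {t u : ℝ} (ht : 0 < t) (hu : 0 < u)
    (x : EuclideanSpace ℝ (Fin n)) :
    ∫⁻ y : EuclideanSpace ℝ (Fin n), ENNReal.ofReal
      (t ^ (-((n:ℝ) / 2)) * Real.exp (-(π * ‖x - y‖ ^ 2 / t)) * Real.exp (-(π * ‖y‖ ^ 2 * u))) =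
    ENNReal.ofReal ((1 + t * u) ^ (-((n:ℝ) / 2)) *
      Real.exp (-(π * ‖x‖ ^ 2 / (1 + t * u) * u))) := by
  have hb : 0 < π * (1 + t * u) / t := by positivity
  have h1 : ∀ y : EuclideanSpace ℝ (Fin n),
      t ^ (-((n:ℝ) / 2)) * Real.exp (-(π * ‖x - y‖ ^ 2 / t)) * Real.exp (-(π * ‖y‖ ^ 2 * u)) =
      (t ^ (-((n:ℝ) / 2)) * Real.exp (-(π * ‖x‖ ^ 2 / (1 + t * u) * u))) *
       Real.exp (-(π * (1 + t * u) / t) * ‖y - (1 + t * u)⁻¹ • x‖ ^ 2) := by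
    intro y
    rw [mul_assoc (t ^ (-((n:ℝ) / 2))), mul_assoc (t ^ (-((n:ℝ) / 2))), ← Real.exp_add,
      ← Real.exp_add]
    congr 2
    rw [norm_sub_sq_real, norm_sub_sq_real, inner_smul_right, norm_smul, real_inner_comm y x,
      mul_pow, Real.norm_eq_abs, sq_abs]
    have : (1 + t * u) ≠ 0 := by positivity
    field_simp
    ring
  simp_rw [h1]
  have hg := GaussianFourier.integral_rexp_neg_mul_sq_norm (V := EuclideanSpace ℝ (Fin n)) hb
  have hi : Integrable (fun v : EuclideanSpace ℝ (Fin n) =>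
      Real.exp (-(π * (1 + t * u) / t) * ‖v‖ ^ 2)) := by
    apply Integrable.of_integral_ne_zero
    rw [hg]; positivity
  simp_rw [ENNReal.ofReal_mul (show 0 ≤ t ^ (-((n:ℝ) / 2)) *
    Real.exp (-(π * ‖x‖ ^ 2 / (1 + t * u) * u)) by positivity)]
  rw [lintegral_const_mul _ (by fun_prop)]
  rw [lintegral_sub_right_eq_self (fun y : EuclideanSpace ℝ (Fin n) => ENNReal.ofReal
    (Real.exp (-(π * (1 + t * u) / t) * ‖y‖ ^ 2))) ((1 + t * u)⁻¹ • x),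
    ← ofReal_integral_eq_lintegral_ofReal hi (by filter_upwards with y; positivity), hg,
    ← ENNReal.ofReal_mul (by positivity)]
  congr 1
  rw [show π / (π * (1 + t * u) / t) = t * (1 + t * u)⁻¹ by field_simp, finrank_euclideanSpace_fin,
    Real.mul_rpow (by positivity) (by positivity), Real.inv_rpow (by positivity),
    Real.rpow_neg (by positivity), Real.rpow_neg (by positivity)]
  have : t ^ ((n:ℝ) / 2) ≠ 0 := by positivity
  field_simp

lemma ae_ne_zero {n : ℕ} (hn : 1 ≤ n) : ∀ᵐ x : EuclideanSpace ℝ (Fin n), x ≠ 0 := by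
  have : Nonempty (Fin n) := ⟨⟨0, hn⟩⟩
  exact Measure.ae_ne volume 0

lemma riesz_gamma {n : ℕ} {a : ℝ} (ha : 0 < a) {y : EuclideanSpace ℝ (Fin n)} (hy : y ≠ 0) :
    ENNReal.ofReal (‖y‖ ^ (-(2 * a))) = ENNReal.ofReal (π ^ a / Real.Gamma a) *
      ∫⁻ u in Set.Ioi (0:ℝ), ENNReal.ofReal (u ^ (a - 1) * Real.exp (-(π * ‖y‖ ^ 2 * u))) := by
  have hG := Real.Gamma_pos_of_pos ha
  have hy' : 0 < ‖y‖ := norm_pos_iff.2 hy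
  rw [lintegral_gamma ha (by positivity), ← ENNReal.ofReal_mul (by positivity)]
  congr 1
  rw [Real.mul_rpow (by positivity) (by positivity), ← Real.rpow_natCast_mul hy'.le,
    Real.rpow_neg pi_pos.le, Nat.cast_ofNat, mul_neg]
  have : π ^ a ≠ 0 := by positivity
  field_simp

lemma riesz_comp {n : ℕ} (hn : 1 ≤ n) {α : ℝ} (hα : 0 < α) (hαn : α < (n:ℝ) / 4)
    {x : EuclideanSpace ℝ (Fin n)} (hx : x ≠ 0) :
    ∫⁻ t in Set.Ioi (0:ℝ), ∫⁻ y : EuclideanSpace ℝ (Fin n),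
      ENNReal.ofReal (t ^ (α - 1)) *
      (ENNReal.ofReal (t ^ (-((n:ℝ) / 2)) * Real.exp (-(π * ‖x - y‖ ^ 2 / t))) *
        ENNReal.ofReal (‖y‖ ^ (-((n:ℝ) / 2)))) =
    ENNReal.ofReal (π ^ α * Real.Gamma ((n:ℝ) / 4 - α) * Real.Gamma α / Real.Gamma ((n:ℝ) / 4 + α)
      * ‖x‖ ^ (2 * α - (n:ℝ) / 2)) := by
  set k : ℝ := (n:ℝ) / 4 with hk
  have hk0 : 0 < k := by have : (1:ℝ) ≤ n := by exact_mod_cast hn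
                         positivity
  have hn2 : (n:ℝ) / 2 = 2 * k := by rw [hk]; ring
  have hG := Real.Gamma_pos_of_pos hk0
  have hG2 := Real.Gamma_pos_of_pos (sub_pos.2 hαn)
  have hG3 := Real.Gamma_pos_of_pos hα
  have hG4 := Real.Gamma_pos_of_pos (add_pos hk0 hα)
  have hx' : 0 < ‖x‖ := norm_pos_iff.2 hx
  have h1 : ∀ t ∈ Set.Ioi (0:ℝ), (∫⁻ y : EuclideanSpace ℝ (Fin n),
      ENNReal.ofReal (t ^ (α - 1)) *
      (ENNReal.ofReal (t ^ (-((n:ℝ) / 2)) * Real.exp (-(π * ‖x - y‖ ^ 2 / t))) *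
        ENNReal.ofReal (‖y‖ ^ (-((n:ℝ) / 2))))) =
      ENNReal.ofReal (π ^ k / Real.Gamma k) * ∫⁻ u in Set.Ioi (0:ℝ),
        ENNReal.ofReal (t ^ (α - 1) * (u ^ (k - 1) * ((1 + t * u) ^ (-((n:ℝ) / 2)) *
          Real.exp (-(π * ‖x‖ ^ 2 / (1 + t * u) * u))))) := by
    intro t ht
    have ht' : (0:ℝ) < t := ht
    have e1 : ∀ᵐ y : EuclideanSpace ℝ (Fin n), ENNReal.ofReal (t ^ (α - 1)) *
      (ENNReal.ofReal (t ^ (-((n:ℝ) / 2)) * Real.exp (-(π * ‖x - y‖ ^ 2 / t))) *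
        ENNReal.ofReal (‖y‖ ^ (-((n:ℝ) / 2)))) =
        ENNReal.ofReal (π ^ k / Real.Gamma k) * ∫⁻ u in Set.Ioi (0:ℝ),
          ENNReal.ofReal (t ^ (α - 1) * (u ^ (k - 1) * (t ^ (-((n:ℝ) / 2)) *
            Real.exp (-(π * ‖x - y‖ ^ 2 / t)) * Real.exp (-(π * ‖y‖ ^ 2 * u))))) := by
      filter_upwards [ae_ne_zero hn] with y hy
      conv_lhs => rw [hn2, riesz_gamma hk0 hy, ← mul_assoc, ← ENNReal.ofReal_mul (by positivity),
        mul_left_comm]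
      rw [← lintegral_const_mul _ (by fun_prop)]
      congr 1
      apply lintegral_congr
      intro u
      rw [← ENNReal.ofReal_mul (by positivity)]
      congr 1
      rw [hn2]; ring
    rw [lintegral_congr_ae e1, lintegral_const_mul _ (by
      apply Measurable.lintegral_prod_right'
        (f := fun p : EuclideanSpace ℝ (Fin n) × ℝ => ENNReal.ofReal (t ^ (α - 1) * (p.2 ^ (k - 1) *
          (t ^ (-((n:ℝ) / 2)) * Real.exp (-(π * ‖x - p.1‖ ^ 2 / t)) *
          Real.exp (-(π * ‖p.1‖ ^ 2 * p.2))))))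
      fun_prop), lintegral_lintegral_swap (by fun_prop)]
    congr 1
    apply setLIntegral_congr_fun measurableSet_Ioi
    intro u hu
    have hu' : (0:ℝ) < u := hu
    simp only
    simp_rw [ENNReal.ofReal_mul (show 0 ≤ t ^ (α - 1) by positivity),
      ENNReal.ofReal_mul (show 0 ≤ u ^ (k - 1) by positivity)]
    rw [lintegral_const_mul _ (by fun_prop), lintegral_const_mul _ (by fun_prop),
      lintegral_gauss ht' hu']
  rw [setLIntegral_congr_fun measurableSet_Ioi h1, lintegral_const_mul _ (by
      apply Measurable.lintegral_prod_right'
        (f := fun p : ℝ × ℝ => ENNReal.ofReal (p.1 ^ (α - 1) * (p.2 ^ (k - 1) *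
          ((1 + p.1 * p.2) ^ (-((n:ℝ) / 2)) *
          Real.exp (-(π * ‖x‖ ^ 2 / (1 + p.1 * p.2) * p.2))))))
      fun_prop), lintegral_lintegral_swap (by fun_prop)]
  have h2 : ∀ u ∈ Set.Ioi (0:ℝ), (∫⁻ t in Set.Ioi (0:ℝ),
      ENNReal.ofReal (t ^ (α - 1) * (u ^ (k - 1) * ((1 + t * u) ^ (-((n:ℝ) / 2)) *
          Real.exp (-(π * ‖x‖ ^ 2 / (1 + t * u) * u)))))) =
      ∫⁻ τ in Set.Ioi (0:ℝ), ENNReal.ofReal (τ ^ (α - 1) * (1 + τ) ^ (-((n:ℝ) / 2)) *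
         (u ^ (k - α - 1) * Real.exp (-(π * ‖x‖ ^ 2 / (1 + τ) * u)))) := by
    intro u hu
    have hu' : (0:ℝ) < u := hu
    rw [lintegral_scale u⁻¹ (by positivity)]
    apply setLIntegral_congr_fun measurableSet_Ioi
    intro τ hτ
    have hτ' : (0:ℝ) < τ := hτ
    simp only
    rw [← ENNReal.ofReal_mul (by positivity)]
    congr 1
    rw [show u⁻¹ * τ * u = τ by field_simp, Real.mul_rpow (by positivity) (by positivity),
      Real.inv_rpow hu'.le, show k - α - 1 = (k - 1) + (-(α - 1) + -1) by ring,
      Real.rpow_add hu', Real.rpow_add hu', Real.rpow_neg_one, Real.rpow_neg hu'.le]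
    ring
  rw [setLIntegral_congr_fun measurableSet_Ioi h2, lintegral_lintegral_swap (by fun_prop)]
  have h3 : ∀ τ ∈ Set.Ioi (0:ℝ), (∫⁻ u in Set.Ioi (0:ℝ),
      ENNReal.ofReal (τ ^ (α - 1) * (1 + τ) ^ (-((n:ℝ) / 2)) *
         (u ^ (k - α - 1) * Real.exp (-(π * ‖x‖ ^ 2 / (1 + τ) * u))))) =
      ENNReal.ofReal (Real.Gamma (k - α) * (π * ‖x‖ ^ 2) ^ (-(k - α))) *
        ENNReal.ofReal (τ ^ (α - 1) * (1 + τ) ^ (-(k + α))) := by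
    intro τ hτ
    have hτ' : (0:ℝ) < τ := hτ
    have h1τ : 0 < 1 + τ := by positivity
    simp_rw [ENNReal.ofReal_mul (show 0 ≤ τ ^ (α - 1) * (1 + τ) ^ (-((n:ℝ) / 2)) by positivity)]
    rw [lintegral_const_mul _ (by fun_prop), lintegral_gamma (sub_pos.2 hαn) (by positivity),
      ← ENNReal.ofReal_mul (by positivity), ← ENNReal.ofReal_mul (by positivity)]
    congr 1
    rw [Real.div_rpow (by positivity) h1τ.le, hn2, show -(k + α) = -(2 * k) - (-(k - α)) by ring,
      Real.rpow_sub h1τ]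
    ring
  rw [setLIntegral_congr_fun measurableSet_Ioi h3, lintegral_const_mul _ (by fun_prop),
    lintegral_beta hα hk0, ← ENNReal.ofReal_mul (by positivity),
    ← ENNReal.ofReal_mul (by positivity)]
  congr 1
  rw [Real.mul_rpow (by positivity) (by positivity), ← Real.rpow_natCast_mul hx'.le,
    show ((2:ℕ):ℝ) * -(k - α) = 2 * α - (n:ℝ) / 2 by rw [hn2]; push_cast; ring,
    show -(k - α) = α - k by ring, Real.rpow_sub pi_pos]
  have : π ^ k ≠ 0 := by positivity
  field_simp

open scoped FourierTransform SchwartzMap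

lemma gauss_fourier {n : ℕ} (g : 𝓢(EuclideanSpace ℝ (Fin n), ℂ)) {t : ℝ} (ht : 0 < t) :
    ∫⁻ ξ : EuclideanSpace ℝ (Fin n),
      ENNReal.ofReal (Real.exp (-(π * ‖ξ‖ ^ 2 * t))) * ‖(𝓕 g) ξ‖ₑ ^ 2 ≤
    ∫⁻ x : EuclideanSpace ℝ (Fin n), ∫⁻ y : EuclideanSpace ℝ (Fin n),
      ‖g x‖ₑ * ‖g y‖ₑ *
        ENNReal.ofReal (t ^ (-((n:ℝ) / 2)) * Real.exp (-(π * ‖x - y‖ ^ 2 / t))) := by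
  set F : 𝓢(EuclideanSpace ℝ (Fin n), ℂ) := 𝓕 g with hF
  set G : EuclideanSpace ℝ (Fin n) → ℝ := fun ξ => Real.exp (-(π * ‖ξ‖ ^ 2 * t)) with hG
  have hGc : Continuous G := by fun_prop
  have hG1 : ∀ ξ, ‖G ξ‖ ≤ 1 := by
    intro ξ
    rw [Real.norm_eq_abs, abs_of_pos (Real.exp_pos _), Real.exp_le_one_iff]
    have : 0 ≤ π * ‖ξ‖ ^ 2 * t := by positivity
    linarith
  have hGc1 : ∀ ξ, ‖((G ξ : ℝ) : ℂ)‖ ≤ 1 := fun ξ => by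
    rw [Complex.norm_real]; exact hG1 ξ
  -- integrability
  have hFi : Integrable (fun ξ => (G ξ : ℂ) * (starRingEnd ℂ) (F ξ)) := by
    have h0 : Integrable (fun ξ => (starRingEnd ℂ) (F ξ)) := by
      have := F.integrable (μ := volume)
      refine this.mono (by
        exact (Complex.continuous_conj.comp F.continuous).aestronglyMeasurable) ?_
      filter_upwards with ξ
      simp
    refine h0.bdd_mul (c := 1) (Complex.continuous_ofReal.comp hGc).aestronglyMeasurable ?_
    filter_upwards with ξ using hGc1 ξ
  have key1 : ∫ ξ, F ξ * ((G ξ : ℂ) * (starRingEnd ℂ) (F ξ)) =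
      ∫ x, g x * 𝓕 (fun ξ => (G ξ : ℂ) * (starRingEnd ℂ) (F ξ)) x := by
    have := VectorFourier.integral_fourierIntegral_smul_eq_flip (L := innerₗ _) (μ := volume)
      (ν := volume) (e := 𝐞) Real.continuous_fourierChar continuous_inner
      (f := (g : EuclideanSpace ℝ (Fin n) → ℂ)) g.integrable hFi
    simpa using! this
  have key2 : ∀ x, 𝓕 (fun ξ => (G ξ : ℂ) * (starRingEnd ℂ) (F ξ)) x =
      (starRingEnd ℂ) (∫ y, g y * ((t ^ (-((n:ℝ) / 2)) * Real.exp (-(π * ‖x - y‖ ^ 2 / t)) : ℝ) : ℂ)) := by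
    intro x
    have hb : 0 < ((π * t : ℝ) : ℂ).re := by simp; positivity
    have hgi := GaussianFourier.integrable_cexp_neg_mul_sq_norm_add
      (V := EuclideanSpace ℝ (Fin n)) hb (2 * π * Complex.I) x
    have h3 := VectorFourier.integral_fourierIntegral_smul_eq_flip (L := innerₗ _) (μ := volume)
      (ν := volume) (e := 𝐞) Real.continuous_fourierChar continuous_inner
      (f := (g : EuclideanSpace ℝ (Fin n) → ℂ)) g.integrable hgi
    have h4 : ∀ y, 𝓕 (fun v : EuclideanSpace ℝ (Fin n) =>
        Complex.exp (-((π * t : ℝ) : ℂ) * ‖v‖ ^ 2 + 2 * π * Complex.I * (⟪x, v⟫ : ℝ))) y =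
        ((t ^ (-((n:ℝ) / 2)) * Real.exp (-(π * ‖x - y‖ ^ 2 / t)) : ℝ) : ℂ) := by
      intro y
      rw [fourier_gaussian_innerProductSpace' hb]
      rw [finrank_euclideanSpace_fin]
      push_cast
      congr 1
      · rw [show ((π:ℂ) / (π * t)) = ((t⁻¹ : ℝ) : ℂ) by
          have : (π:ℂ) ≠ 0 := by exact_mod_cast pi_pos.ne'
          push_cast; field_simp, show ((n:ℂ) / 2) = (((n:ℝ) / 2 : ℝ) : ℂ) by push_cast; rfl,
          ← Complex.ofReal_cpow (by positivity), Real.inv_rpow ht.le, ← Real.rpow_neg ht.le]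
      · congr 1
        have : (π:ℂ) ≠ 0 := by exact_mod_cast pi_pos.ne'
        have : (t:ℂ) ≠ 0 := by exact_mod_cast ht.ne'
        field_simp
    have h5 : ∫ ξ, F ξ * Complex.exp (-((π * t : ℝ) : ℂ) * ‖ξ‖ ^ 2 +
        2 * π * Complex.I * (⟪x, ξ⟫ : ℝ)) = ∫ y, g y * ((t ^ (-((n:ℝ) / 2)) *
          Real.exp (-(π * ‖x - y‖ ^ 2 / t)) : ℝ) : ℂ) := by
      simp_rw [← h4]
      simpa using! h3
    rw [← h5, ← integral_conj, Real.fourier_eq']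
    congr 1
    ext ξ
    rw [map_mul, ← Complex.exp_conj, smul_eq_mul]
    simp only [hG, map_add, map_mul, map_neg, Complex.conj_ofReal, Complex.conj_I, map_pow,
      map_ofNat]
    rw [Complex.exp_add, real_inner_comm ξ x]
    push_cast
    have e1 : Complex.exp (-(π * t) * ‖ξ‖ ^ 2) = Complex.exp (-(π * ‖ξ‖ ^ 2 * t)) := by
      congr 1; ring
    have e2 : Complex.exp (2 * π * -Complex.I * (⟪ξ, x⟫ : ℝ)) =
      Complex.exp (-2 * π * (⟪ξ, x⟫ : ℝ) * Complex.I) := by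
      congr 1; ring
    rw [e1, e2]; ring_nf
  have hlhs : ∫⁻ ξ : EuclideanSpace ℝ (Fin n), ENNReal.ofReal (G ξ) * ‖F ξ‖ₑ ^ 2 =
      ‖∫ ξ, F ξ * ((G ξ : ℂ) * (starRingEnd ℂ) (F ξ))‖ₑ := by
    have e : ∀ ξ, F ξ * ((G ξ : ℂ) * (starRingEnd ℂ) (F ξ)) = ((G ξ * ‖F ξ‖ ^ 2 : ℝ) : ℂ) := by
      intro ξ
      rw [mul_left_comm, Complex.mul_conj, Complex.normSq_eq_norm_sq]; push_cast; rfl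
    have hi2 : Integrable (fun ξ => G ξ * ‖F ξ‖ ^ 2) := by
      have := (F.memLp 2 volume).integrable_norm_pow (by norm_num)
      refine this.bdd_mul (c := 1) hGc.aestronglyMeasurable ?_
      filter_upwards with ξ using hG1 ξ
    simp_rw [e]
    rw [integral_complex_ofReal]
    rw [show ‖((∫ ξ, G ξ * ‖F ξ‖ ^ 2 : ℝ) : ℂ)‖ₑ = ENNReal.ofReal (∫ ξ, G ξ * ‖F ξ‖ ^ 2) by
      rw [← ofReal_norm, Complex.norm_real, Real.norm_of_nonneg]
      exact integral_nonneg fun ξ => by positivity]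
    rw [ofReal_integral_eq_lintegral_ofReal hi2 (by filter_upwards with ξ; positivity)]
    apply lintegral_congr
    intro ξ
    rw [ENNReal.ofReal_mul (by positivity), ENNReal.ofReal_pow (by positivity),
      ofReal_norm]
  rw [hlhs, key1]
  refine (enorm_integral_le_lintegral_enorm _).trans ?_
  apply lintegral_mono
  intro x
  simp only [enorm_mul]
  rw [key2 x]
  have : ∀ z : ℂ, ‖(starRingEnd ℂ) z‖ₑ = ‖z‖ₑ := fun z => by
    rw [← ofReal_norm, ← ofReal_norm]; simp
  rw [this]
  simp_rw [mul_assoc]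
  rw [lintegral_const_mul _ (by fun_prop)]
  gcongr
  refine (enorm_integral_le_lintegral_enorm _).trans ?_
  apply lintegral_mono
  intro y
  simp only [enorm_mul]
  gcongr
  rw [← ofReal_norm, Complex.norm_real, Real.norm_of_nonneg (by positivity)]

lemma schur_symm {X : Type*} [MeasurableSpace X] {μ : Measure X} [SFinite μ]
    (K T : X → X → ℝ≥0∞) (hTm : Measurable (Function.uncurry T))
    (hpt : ∀ᵐ x ∂μ, ∀ᵐ y ∂μ, K x y ≤ 2⁻¹ * (T x y + T y x)) :
    ∫⁻ x, ∫⁻ y, K x y ∂μ ∂μ ≤ ∫⁻ x, ∫⁻ y, T x y ∂μ ∂μ := by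
  have hTm' : Measurable (fun p : X × X => T p.2 p.1) := hTm.comp measurable_swap
  have hswap : ∫⁻ x, ∫⁻ y, T y x ∂μ ∂μ = ∫⁻ x, ∫⁻ y, T x y ∂μ ∂μ :=
    lintegral_lintegral_swap hTm'.aemeasurable
  calc ∫⁻ x, ∫⁻ y, K x y ∂μ ∂μ
      ≤ ∫⁻ x, ∫⁻ y, 2⁻¹ * (T x y + T y x) ∂μ ∂μ := by
        apply lintegral_mono_ae
        filter_upwards [hpt] with x hx
        exact lintegral_mono_ae hx
    _ = 2⁻¹ * ((∫⁻ x, ∫⁻ y, T x y ∂μ ∂μ) + ∫⁻ x, ∫⁻ y, T y x ∂μ ∂μ) := by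
        have h2 : (2⁻¹ : ℝ≥0∞) ≠ ⊤ := by norm_num
        have hm1 : Measurable (fun x => ∫⁻ y, T x y ∂μ) := hTm.lintegral_prod_right'
        rw [← lintegral_add_left hm1, ← lintegral_const_mul' _ _ h2]
        apply lintegral_congr
        intro x
        have hm2 : Measurable (fun y => T x y) := hTm.comp measurable_prodMk_left
        rw [lintegral_const_mul' _ _ h2, lintegral_add_left hm2]
    _ = ∫⁻ x, ∫⁻ y, T x y ∂μ ∂μ := by
        rw [hswap, ← two_mul, ← mul_assoc, ENNReal.inv_mul_cancel (by norm_num) (by norm_num),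
          one_mul]

lemma schur_step {n : ℕ} (hn : 1 ≤ n) (g : 𝓢(EuclideanSpace ℝ (Fin n), ℂ)) {t : ℝ} (ht : 0 < t) :
    ∫⁻ x : EuclideanSpace ℝ (Fin n), ∫⁻ y : EuclideanSpace ℝ (Fin n),
      ‖g x‖ₑ * ‖g y‖ₑ *
        ENNReal.ofReal (t ^ (-((n:ℝ) / 2)) * Real.exp (-(π * ‖x - y‖ ^ 2 / t))) ≤
    ∫⁻ x : EuclideanSpace ℝ (Fin n), ∫⁻ y : EuclideanSpace ℝ (Fin n),
      ‖g x‖ₑ ^ 2 * ENNReal.ofReal (‖x‖ ^ ((n:ℝ) / 2)) *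
        (ENNReal.ofReal (t ^ (-((n:ℝ) / 2)) * Real.exp (-(π * ‖x - y‖ ^ 2 / t))) *
         ENNReal.ofReal (‖y‖ ^ (-((n:ℝ) / 2)))) := by
  set P : EuclideanSpace ℝ (Fin n) → EuclideanSpace ℝ (Fin n) → ℝ≥0∞ := fun x y =>
    ENNReal.ofReal (t ^ (-((n:ℝ) / 2)) * Real.exp (-(π * ‖x - y‖ ^ 2 / t))) with hP
  set T : EuclideanSpace ℝ (Fin n) → EuclideanSpace ℝ (Fin n) → ℝ≥0∞ := fun x y =>
    ‖g x‖ₑ ^ 2 * ENNReal.ofReal (‖x‖ ^ ((n:ℝ) / 2)) *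
        (P x y * ENNReal.ofReal (‖y‖ ^ (-((n:ℝ) / 2)))) with hT
  have hgm : Measurable (g : EuclideanSpace ℝ (Fin n) → ℂ) := g.continuous.measurable
  have hTm : Measurable (Function.uncurry T) := by
    simp only [hT, hP, Function.uncurry_def]; fun_prop
  refine schur_symm (fun x y => ‖g x‖ₑ * ‖g y‖ₑ * P x y) T hTm ?_
  filter_upwards [ae_ne_zero hn] with x hx
  filter_upwards [ae_ne_zero hn] with y hy
  have hx' : 0 < ‖x‖ := norm_pos_iff.2 hx
  have hy' : 0 < ‖y‖ := norm_pos_iff.2 hy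
  have hPs : P y x = P x y := by simp only [hP]; rw [norm_sub_rev]
  simp only [hT]
  rw [hPs]
  set X := ‖x‖ ^ ((n:ℝ) / 2)
  set Y := ‖y‖ ^ ((n:ℝ) / 2)
  have hX : 0 < X := by positivity
  have hY : 0 < Y := by positivity
  have e : 2⁻¹ * (‖g x‖ₑ ^ 2 * ENNReal.ofReal X * (P x y * ENNReal.ofReal (‖y‖ ^ (-((n:ℝ) / 2))))
      + ‖g y‖ₑ ^ 2 * ENNReal.ofReal Y * (P x y * ENNReal.ofReal (‖x‖ ^ (-((n:ℝ) / 2))))) =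
      ENNReal.ofReal (2⁻¹ * (‖g x‖ ^ 2 * X * Y⁻¹ + ‖g y‖ ^ 2 * Y * X⁻¹)) * P x y := by
    rw [Real.rpow_neg hx'.le, Real.rpow_neg hy'.le, ENNReal.ofReal_mul (by positivity),
      ENNReal.ofReal_add (by positivity) (by positivity), ENNReal.ofReal_mul (by positivity),
      ENNReal.ofReal_mul (by positivity), ENNReal.ofReal_mul (by positivity),
      ENNReal.ofReal_mul (by positivity), ENNReal.ofReal_pow (by positivity),
      ENNReal.ofReal_pow (by positivity), ofReal_norm, ofReal_norm,
      ENNReal.ofReal_inv_of_pos (by norm_num : (0:ℝ) < 2), ENNReal.ofReal_ofNat]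
    ring
  rw [e, ← ofReal_norm (g x), ← ofReal_norm (g y),
    ← ENNReal.ofReal_mul (by positivity)]
  refine mul_le_mul_left (ENNReal.ofReal_le_ofReal ?_) _
  have : 2⁻¹ * (‖g x‖ ^ 2 * X * Y⁻¹ + ‖g y‖ ^ 2 * Y * X⁻¹) - ‖g x‖ * ‖g y‖ =
    (‖g x‖ * X - ‖g y‖ * Y) ^ 2 / (2 * X * Y) := by field_simp; ring
  have h2 : 0 ≤ (‖g x‖ * X - ‖g y‖ * Y) ^ 2 / (2 * X * Y) := by positivity
  linarith

lemma pitt {n : ℕ} (hn : 1 ≤ n) (g : 𝓢(EuclideanSpace ℝ (Fin n), ℂ)) {α : ℝ}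
    (hα : 0 < α) (hαn : α < (n:ℝ) / 4) :
    ∫⁻ ξ : EuclideanSpace ℝ (Fin n), ENNReal.ofReal (‖ξ‖ ^ (-(2 * α))) * ‖(𝓕 g) ξ‖ₑ ^ 2 ≤
    ENNReal.ofReal (π ^ (2 * α) * Real.Gamma ((n:ℝ) / 4 - α) / Real.Gamma ((n:ℝ) / 4 + α)) *
      ∫⁻ x : EuclideanSpace ℝ (Fin n), ENNReal.ofReal (‖x‖ ^ (2 * α)) * ‖g x‖ₑ ^ 2 := by
  have hgm : Measurable (g : EuclideanSpace ℝ (Fin n) → ℂ) := g.continuous.measurable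
  set F : 𝓢(EuclideanSpace ℝ (Fin n), ℂ) := 𝓕 g with hF
  have hFm : Measurable (F : EuclideanSpace ℝ (Fin n) → ℂ) := F.continuous.measurable
  have hG2 := Real.Gamma_pos_of_pos (sub_pos.2 hαn)
  have hG3 := Real.Gamma_pos_of_pos hα
  have hk0 : 0 < (n:ℝ) / 4 := hα.trans hαn
  have hG4 := Real.Gamma_pos_of_pos (add_pos hk0 hα)
  have h1 : ∫⁻ ξ : EuclideanSpace ℝ (Fin n), ENNReal.ofReal (‖ξ‖ ^ (-(2 * α))) * ‖F ξ‖ₑ ^ 2 =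
      ENNReal.ofReal (π ^ α / Real.Gamma α) * ∫⁻ t in Set.Ioi (0:ℝ), ENNReal.ofReal (t ^ (α - 1)) *
      ∫⁻ ξ : EuclideanSpace ℝ (Fin n),
        ENNReal.ofReal (Real.exp (-(π * ‖ξ‖ ^ 2 * t))) * ‖F ξ‖ₑ ^ 2 := by
    have e1 : ∀ᵐ ξ : EuclideanSpace ℝ (Fin n),
        ENNReal.ofReal (‖ξ‖ ^ (-(2 * α))) * ‖F ξ‖ₑ ^ 2 =
        ENNReal.ofReal (π ^ α / Real.Gamma α) * ∫⁻ t in Set.Ioi (0:ℝ),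
          ENNReal.ofReal (t ^ (α - 1)) *
            (ENNReal.ofReal (Real.exp (-(π * ‖ξ‖ ^ 2 * t))) * ‖F ξ‖ₑ ^ 2) := by
      filter_upwards [ae_ne_zero hn] with ξ hξ
      rw [riesz_gamma hα hξ, mul_assoc, ← lintegral_mul_const _ (by fun_prop)]
      congr 1
      apply setLIntegral_congr_fun measurableSet_Ioi
      intro t ht
      have ht' : (0:ℝ) < t := ht
      simp only
      rw [ENNReal.ofReal_mul (by positivity), mul_assoc]
    have hm : Measurable (fun p : EuclideanSpace ℝ (Fin n) × ℝ =>  ENNReal.ofReal (p.2 ^ (α - 1)) *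
            (ENNReal.ofReal (Real.exp (-(π * ‖p.1‖ ^ 2 * p.2))) * ‖F p.1‖ₑ ^ 2)) := by
      fun_prop
    rw [lintegral_congr_ae e1, lintegral_const_mul _ hm.lintegral_prod_right',
      lintegral_lintegral_swap hm.aemeasurable]
    congr 1
    apply lintegral_congr
    intro t
    simp only
    rw [lintegral_const_mul' _ _ ENNReal.ofReal_ne_top]
  rw [h1]
  have hm2 : Measurable (fun p : (ℝ × EuclideanSpace ℝ (Fin n)) × EuclideanSpace ℝ (Fin n) =>
      ENNReal.ofReal (p.1.1 ^ (α - 1)) *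
       ((ENNReal.ofReal (p.1.1 ^ (-((n:ℝ) / 2)) * Real.exp (-(π * ‖p.1.2 - p.2‖ ^ 2 / p.1.1))) *
         ENNReal.ofReal (‖p.2‖ ^ (-((n:ℝ) / 2)))))) := by fun_prop
  have h2 : ∫⁻ t in Set.Ioi (0:ℝ), ENNReal.ofReal (t ^ (α - 1)) *
      (∫⁻ ξ : EuclideanSpace ℝ (Fin n),
        ENNReal.ofReal (Real.exp (-(π * ‖ξ‖ ^ 2 * t))) * ‖F ξ‖ₑ ^ 2) ≤
      ∫⁻ t in Set.Ioi (0:ℝ), ∫⁻ x : EuclideanSpace ℝ (Fin n),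
        ‖g x‖ₑ ^ 2 * ENNReal.ofReal (‖x‖ ^ ((n:ℝ) / 2)) *
         ∫⁻ y : EuclideanSpace ℝ (Fin n), ENNReal.ofReal (t ^ (α - 1)) *
        (ENNReal.ofReal (t ^ (-((n:ℝ) / 2)) * Real.exp (-(π * ‖x - y‖ ^ 2 / t))) *
         ENNReal.ofReal (‖y‖ ^ (-((n:ℝ) / 2)))) := by
    apply setLIntegral_mono' measurableSet_Ioi
    intro t ht
    refine (mul_le_mul_right ((gauss_fourier g ht).trans (schur_step hn g ht)) _).trans ?_
    rw [← lintegral_const_mul' _ _ ENNReal.ofReal_ne_top]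
    apply lintegral_mono
    intro x
    simp only
    rw [lintegral_const_mul _ (by fun_prop), lintegral_const_mul _ (by fun_prop), mul_left_comm]
  refine (mul_le_mul_right h2 _).trans ?_
  have hm3 : Measurable (fun p : ℝ × EuclideanSpace ℝ (Fin n) =>
      ‖g p.2‖ₑ ^ 2 * ENNReal.ofReal (‖p.2‖ ^ ((n:ℝ) / 2)) *
         ∫⁻ y : EuclideanSpace ℝ (Fin n), ENNReal.ofReal (p.1 ^ (α - 1)) *
        (ENNReal.ofReal (p.1 ^ (-((n:ℝ) / 2)) * Real.exp (-(π * ‖p.2 - y‖ ^ 2 / p.1))) *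
         ENNReal.ofReal (‖y‖ ^ (-((n:ℝ) / 2))))) :=
    Measurable.mul (by fun_prop) hm2.lintegral_prod_right'
  rw [lintegral_lintegral_swap hm3.aemeasurable, ← lintegral_const_mul' _ _ ENNReal.ofReal_ne_top,
    ← lintegral_const_mul' _ _ ENNReal.ofReal_ne_top]
  apply lintegral_mono_ae
  filter_upwards [ae_ne_zero hn] with x hx
  have hx' : 0 < ‖x‖ := norm_pos_iff.2 hx
  rw [lintegral_const_mul' _ _ (ENNReal.mul_ne_top (ENNReal.pow_ne_top enorm_ne_top) ENNReal.ofReal_ne_top),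
    riesz_comp hn hα hαn hx]
  apply le_of_eq
  have hcomb : ∀ c1 c2 w q d1 d2 : ℝ≥0∞, c1 * c2 * w = d1 * d2 →
      c1 * (q * w * c2) = d1 * (d2 * q) := by
    intro c1 c2 w q d1 d2 h
    rw [← mul_assoc d1, ← h]; ring
  apply hcomb
  rw [← ENNReal.ofReal_mul (by positivity),
    ← ENNReal.ofReal_mul (by positivity), ← ENNReal.ofReal_mul (by positivity)]
  congr 1
  rw [Real.rpow_sub hx', show π ^ (2 * α) = π ^ α * π ^ α by
    rw [← Real.rpow_add pi_pos]; congr 1; ring]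
  have : ‖x‖ ^ ((n:ℝ) / 2) ≠ 0 := by positivity
  field_simp

lemma int_pos {n : ℕ} (g : 𝓢(EuclideanSpace ℝ (Fin n), ℂ)) {β : ℝ} (h0 : 0 ≤ β) (h1 : β ≤ 2) :
    Integrable (fun x => ‖x‖ ^ β * ‖g x‖ ^ 2) := by
  have hb : ∀ x, ‖g x‖ ≤ SchwartzMap.seminorm ℝ 0 0 g := fun x => SchwartzMap.norm_le_seminorm ℝ g x
  have hi := ((g.integrable_pow_mul volume 2).add (g.integrable_pow_mul volume 0)).const_mul
    (SchwartzMap.seminorm ℝ 0 0 g)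
  have hgm : Measurable (g : EuclideanSpace ℝ (Fin n) → ℂ) := g.continuous.measurable
  refine hi.mono' (by fun_prop) ?_
  filter_upwards with x
  rw [Real.norm_of_nonneg (by positivity)]
  have hx : ‖x‖ ^ β ≤ ‖x‖ ^ 2 + 1 := by
    rcases le_total ‖x‖ 1 with h | h
    · have := Real.rpow_le_one (norm_nonneg x) h h0
      nlinarith [sq_nonneg ‖x‖]
    · have := Real.rpow_le_rpow_of_exponent_le h h1
      rw [Real.rpow_two] at this
      linarith
  have h3 : ‖g x‖ ^ 2 ≤ SchwartzMap.seminorm ℝ 0 0 g * ‖g x‖ := by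
    rw [sq]; exact mul_le_mul_of_nonneg_right (hb x) (norm_nonneg _)
  calc ‖x‖ ^ β * ‖g x‖ ^ 2 ≤ (‖x‖ ^ 2 + 1) * (SchwartzMap.seminorm ℝ 0 0 g * ‖g x‖) := by gcongr
    _ = _ := by simp; ring

lemma int_sq {n : ℕ} (g : 𝓢(EuclideanSpace ℝ (Fin n), ℂ)) :
    Integrable (fun x => ‖g x‖ ^ 2) := by
  simpa using int_pos g le_rfl zero_le_two

lemma int_neg {n : ℕ} (hn : 1 ≤ n) (g : 𝓢(EuclideanSpace ℝ (Fin n), ℂ)) {α : ℝ}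
    (h0 : 0 < α) (h1 : α ≤ 1 / 8) :
    Integrable (fun x => ‖x‖ ^ (-(2 * α)) * ‖g x‖ ^ 2) := by
  have hn' : (1:ℝ) ≤ n := by exact_mod_cast hn
  have hgm : Measurable (g : EuclideanSpace ℝ (Fin n) → ℂ) := g.continuous.measurable
  have hp := pitt hn (𝓕⁻ g) h0 (by linarith)
  rw [FourierTransform.fourier_fourierInv_eq] at hp
  have hfin : ENNReal.ofReal (π ^ (2 * α) * Real.Gamma ((n:ℝ) / 4 - α) / Real.Gamma ((n:ℝ) / 4 + α)) *
      ∫⁻ x : EuclideanSpace ℝ (Fin n), ENNReal.ofReal (‖x‖ ^ (2 * α)) * ‖(𝓕⁻ g) x‖ₑ ^ 2 < ∞ := by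
    apply ENNReal.mul_lt_top ENNReal.ofReal_lt_top
    have := (int_pos (𝓕⁻ g) (β := 2 * α) (by positivity) (by linarith)).lintegral_lt_top
    convert this using 3 with x
    rw [ENNReal.ofReal_mul (by positivity), ENNReal.ofReal_pow (by positivity), ofReal_norm]
  refine ⟨by fun_prop, ?_⟩
  rw [hasFiniteIntegral_iff_ofReal (by filter_upwards with x; positivity)]
  refine lt_of_eq_of_lt ?_ (hp.trans_lt hfin)
  apply lintegral_congr
  intro x
  rw [ENNReal.ofReal_mul (by positivity), ENNReal.ofReal_pow (by positivity), ofReal_norm]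

lemma abs_log_le_rpow {r ε : ℝ} (hr : 0 < r) (hε : 0 < ε) :
    |Real.log r| ≤ (r ^ ε + r ^ (-ε)) / ε := by
  have h1 := Real.log_le_rpow_div hr.le hε
  have h2 := Real.log_le_rpow_div (inv_pos.2 hr).le hε
  rw [Real.log_inv, Real.inv_rpow hr.le, ← Real.rpow_neg hr.le] at h2
  have h3 : 0 ≤ r ^ ε / ε := by positivity
  have h4 : 0 ≤ r ^ (-ε) / ε := by positivity
  rw [add_div, abs_le]
  constructor <;> linarith

lemma int_log {n : ℕ} (hn : 1 ≤ n) (g : 𝓢(EuclideanSpace ℝ (Fin n), ℂ)) :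
    Integrable (fun x => Real.log ‖x‖ * ‖g x‖ ^ 2) := by
  have hgm : Measurable (g : EuclideanSpace ℝ (Fin n) → ℂ) := g.continuous.measurable
  have hi := ((int_pos g (β := 1 / 4) (by norm_num) (by norm_num)).add
    (int_neg hn g (α := 1 / 8) (by norm_num) le_rfl)).const_mul 4
  refine hi.mono' (by fun_prop) ?_
  filter_upwards [ae_ne_zero hn] with x hx
  have hx' : 0 < ‖x‖ := norm_pos_iff.2 hx
  have := abs_log_le_rpow hx' (ε := 1 / 4) (by norm_num)
  rw [norm_mul, Real.norm_eq_abs, Real.norm_of_nonneg (sq_nonneg _)]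
  calc |Real.log ‖x‖| * ‖g x‖ ^ 2 ≤ ((‖x‖ ^ (1 / 4 : ℝ) + ‖x‖ ^ (-(1 / 4) : ℝ)) / (1 / 4)) * ‖g x‖ ^ 2 := by gcongr
    _ = _ := by simp only [Pi.add_apply]; rw [show (-(2 * (1 / 8)) : ℝ) = -(1 / 4) by norm_num]; ring

lemma hasDerivAt_moment {n : ℕ} (hn : 1 ≤ n) (g : 𝓢(EuclideanSpace ℝ (Fin n), ℂ)) :
    HasDerivAt (fun α : ℝ => ∫ x : EuclideanSpace ℝ (Fin n), ‖x‖ ^ (2 * α) * ‖g x‖ ^ 2)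
      (∫ x : EuclideanSpace ℝ (Fin n), 2 * (Real.log ‖x‖ * ‖g x‖ ^ 2)) 0 := by
  have hgm : Measurable (g : EuclideanSpace ℝ (Fin n) → ℂ) := g.continuous.measurable
  have hi := (((int_pos g (β := 1 / 4) (by norm_num) (by norm_num)).add
    (int_neg hn g (α := 1 / 8) (by norm_num) le_rfl)).add ((int_sq g).const_mul 2)).const_mul 16
  have := (hasDerivAt_integral_of_dominated_loc_of_deriv_le
    (F := fun (α : ℝ) (x : EuclideanSpace ℝ (Fin n)) => ‖x‖ ^ (2 * α) * ‖g x‖ ^ 2)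
    (F' := fun (α : ℝ) (x : EuclideanSpace ℝ (Fin n)) =>
      Real.log ‖x‖ * 2 * ‖x‖ ^ (2 * α) * ‖g x‖ ^ 2) (x₀ := 0) (μ := volume)
    (Metric.ball_mem_nhds (0:ℝ) (show (0:ℝ) < 1 / 16 by norm_num)) (by
      filter_upwards with α
      have : Measurable (fun x : EuclideanSpace ℝ (Fin n) => ‖x‖ ^ (2 * α) * ‖g x‖ ^ 2) := by
        fun_prop
      exact this.aestronglyMeasurable) (by simpa using int_sq g) (by fun_prop) ?_ hi ?_).2
  · have e : (fun x : EuclideanSpace ℝ (Fin n) => 2 * (Real.log ‖x‖ * ‖g x‖ ^ 2)) =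
        (fun a => Real.log ‖a‖ * 2 * ‖a‖ ^ (2 * (0:ℝ)) * ‖g a‖ ^ 2) := by
      ext x
      rw [mul_zero, Real.rpow_zero]
      ring
    rw [e]
    exact this
  · filter_upwards [ae_ne_zero hn] with x hx α hα
    have hx' : 0 < ‖x‖ := norm_pos_iff.2 hx
    have hl := abs_log_le_rpow hx' (ε := 1 / 8) (by norm_num)
    rw [Metric.mem_ball, dist_zero_right, Real.norm_eq_abs, abs_lt] at hα
    have hp : ‖x‖ ^ (2 * α) ≤ ‖x‖ ^ (1 / 8 : ℝ) + ‖x‖ ^ (-(1 / 8) : ℝ) := by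
      have p1 : 0 < ‖x‖ ^ (1 / 8 : ℝ) := by positivity
      have p2 : 0 < ‖x‖ ^ (-(1 / 8) : ℝ) := by positivity
      rcases le_total ‖x‖ 1 with h | h
      · have := Real.rpow_le_rpow_of_exponent_ge hx' h (show -(1 / 8) ≤ 2 * α by linarith)
        linarith
      · have := Real.rpow_le_rpow_of_exponent_le h (show 2 * α ≤ 1 / 8 by linarith)
        linarith
    have e1 : ‖x‖ ^ (1 / 4 : ℝ) = ‖x‖ ^ (1 / 8 : ℝ) * ‖x‖ ^ (1 / 8 : ℝ) := by
      rw [← Real.rpow_add hx']; norm_num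
    have e2 : ‖x‖ ^ (-(2 * (1 / 8)) : ℝ) = ‖x‖ ^ (-(1 / 8) : ℝ) * ‖x‖ ^ (-(1 / 8) : ℝ) := by
      rw [← Real.rpow_add hx']; norm_num
    have e3 : ‖x‖ ^ (1 / 8 : ℝ) * ‖x‖ ^ (-(1 / 8) : ℝ) = 1 := by
      rw [← Real.rpow_add hx']; norm_num
    rw [norm_mul, norm_mul, norm_mul, Real.norm_eq_abs (Real.log _),
      Real.norm_of_nonneg (sq_nonneg ‖g x‖), Real.norm_of_nonneg (Real.rpow_nonneg hx'.le _),
      Real.norm_of_nonneg (zero_le_two (α := ℝ))]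
    simp only [Pi.add_apply]
    rw [e1, e2]
    set p := ‖x‖ ^ (1 / 8 : ℝ)
    set q := ‖x‖ ^ (-(1 / 8) : ℝ)
    calc |Real.log ‖x‖| * 2 * ‖x‖ ^ (2 * α) * ‖g x‖ ^ 2
        ≤ ((p + q) / (1 / 8)) * 2 * (p + q) * ‖g x‖ ^ 2 := by gcongr
      _ = 16 * (p * p + q * q + 2 * (p * q)) * ‖g x‖ ^ 2 := by ring
      _ = _ := by rw [e3]; ring
  · filter_upwards [ae_ne_zero hn] with x hx α hα
    have hx' : 0 < ‖x‖ := norm_pos_iff.2 hx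
    have h1 : HasDerivAt (fun α : ℝ => 2 * α) 2 α := by
      simpa using (hasDerivAt_id α).const_mul 2
    exact (h1.const_rpow hx').mul_const _

lemma beckner {n : ℕ} (hn : 1 ≤ n) (g : 𝓢(EuclideanSpace ℝ (Fin n), ℂ)) :
    (deriv Real.Gamma ((n : ℝ) / 4) / Real.Gamma ((n : ℝ) / 4) - Real.log π) *
      (∫ x : EuclideanSpace ℝ (Fin n), ‖g x‖ ^ 2) ≤
    (∫ x : EuclideanSpace ℝ (Fin n), Real.log ‖x‖ * ‖g x‖ ^ 2) +
      ∫ ξ : EuclideanSpace ℝ (Fin n), Real.log ‖ξ‖ * ‖(𝓕 g) ξ‖ ^ 2 := by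
  have hn' : (1:ℝ) ≤ n := by exact_mod_cast hn
  set k : ℝ := (n:ℝ) / 4 with hk
  have hk0 : 0 < k := by positivity
  have hGk := Real.Gamma_pos_of_pos hk0
  set N := ∫ x : EuclideanSpace ℝ (Fin n), ‖g x‖ ^ 2 with hN
  set Lg := ∫ x : EuclideanSpace ℝ (Fin n), Real.log ‖x‖ * ‖g x‖ ^ 2 with hLg
  set LF := ∫ ξ : EuclideanSpace ℝ (Fin n), Real.log ‖ξ‖ * ‖(𝓕 g) ξ‖ ^ 2 with hLF
  set M : ℝ → ℝ := fun α => ∫ x : EuclideanSpace ℝ (Fin n), ‖x‖ ^ (2 * α) * ‖g x‖ ^ 2 with hM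
  set K : ℝ → ℝ := fun α => π ^ (2 * α) * Real.Gamma (k - α) / Real.Gamma (k + α) with hK
  have hM0 : M 0 = N := by simp [hM, hN]
  have hK0 : K 0 = 1 := by simp [hK, hGk.ne']
  have hMd : HasDerivAt M (2 * Lg) 0 := by
    have := hasDerivAt_moment hn g
    rwa [integral_const_mul] at this
  have hGd : HasDerivAt Real.Gamma (deriv Real.Gamma k) k := by
    apply (Real.differentiableAt_Gamma _).hasDerivAt
    intro m
    have : (0:ℝ) ≤ m := m.cast_nonneg
    intro h
    linarith
  have hKd : HasDerivAt K (2 * Real.log π - 2 * (deriv Real.Gamma k / Real.Gamma k)) 0 := by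
    have h1 : HasDerivAt (fun α : ℝ => 2 * α) 2 0 := by
      simpa using (hasDerivAt_id (0:ℝ)).const_mul 2
    have h2 := h1.const_rpow pi_pos
    have h3 : HasDerivAt (fun α : ℝ => Real.Gamma (k - α)) (-deriv Real.Gamma k) 0 := by
      have := HasDerivAt.comp_const_sub (f := Real.Gamma) (f' := deriv Real.Gamma k) k 0 (by simpa using hGd)
      simpa using this
    have h4 : HasDerivAt (fun α : ℝ => Real.Gamma (k + α)) (deriv Real.Gamma k) 0 :=
      HasDerivAt.comp_const_add (f := Real.Gamma) k 0 (by simpa using hGd)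
    have h5 := (h2.mul h3).div h4 (by simpa using hGk.ne')
    refine HasDerivAt.congr_deriv (f' := _) h5 ?_
    simp only [Pi.mul_apply, mul_zero, Real.rpow_zero, sub_zero, add_zero]
    field_simp
    ring
  have hφ : HasDerivAt (fun α => K α * M α - N + 2 * α * LF)
      ((2 * Real.log π - 2 * (deriv Real.Gamma k / Real.Gamma k)) * N + 2 * Lg + 2 * LF) 0 := by
    have h1 : HasDerivAt (fun α : ℝ => 2 * α) 2 0 := by
      simpa using (hasDerivAt_id (0:ℝ)).const_mul 2
    have := ((hKd.mul hMd).sub_const N).add (h1.mul_const LF)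
    rw [hM0, hK0, one_mul] at this
    exact this
  have hineq : ∀ α : ℝ, 0 < α → α < 1 / 8 → 0 ≤ K α * M α - N + 2 * α * LF := by
    intro α h0 h1
    have hp := pitt hn g h0 (by linarith)
    have hiF := int_neg hn (𝓕 g) h0 h1.le
    have hig := int_pos g (β := 2 * α) (by positivity) (by linarith)
    have hG2 := Real.Gamma_pos_of_pos (show 0 < k - α by rw [hk]; linarith)
    have hG4 := Real.Gamma_pos_of_pos (add_pos hk0 h0)
    have hp2 : ∫ ξ : EuclideanSpace ℝ (Fin n), ‖ξ‖ ^ (-(2 * α)) * ‖(𝓕 g) ξ‖ ^ 2 ≤ K α * M α := by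
      have hKM : 0 ≤ K α * M α := mul_nonneg (by simp only [hK]; positivity)
        (integral_nonneg fun x => by positivity)
      rw [← ENNReal.ofReal_le_ofReal_iff hKM, ENNReal.ofReal_mul (by simp only [hK]; positivity),
        ofReal_integral_eq_lintegral_ofReal hiF (by filter_upwards with x; positivity),
        ofReal_integral_eq_lintegral_ofReal hig (by filter_upwards with x; positivity)]
      refine (le_of_eq ?_).trans (hp.trans (le_of_eq ?_))
      · apply lintegral_congr
        intro x
        rw [ENNReal.ofReal_mul (by positivity), ENNReal.ofReal_pow (by positivity), ofReal_norm]
      · congr 1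
        apply lintegral_congr
        intro x
        rw [ENNReal.ofReal_mul (by positivity), ENNReal.ofReal_pow (by positivity), ofReal_norm]
    have hp3 : N - 2 * α * LF ≤ ∫ ξ : EuclideanSpace ℝ (Fin n), ‖ξ‖ ^ (-(2 * α)) * ‖(𝓕 g) ξ‖ ^ 2 := by
      have hNF : N = ∫ ξ : EuclideanSpace ℝ (Fin n), ‖(𝓕 g) ξ‖ ^ 2 := 
        (SchwartzMap.integral_norm_sq_fourier g).symm
      rw [hNF, hLF, ← integral_const_mul, ← integral_sub (int_sq _) ((int_log hn _).const_mul _)]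
      apply integral_mono_ae ((int_sq _).sub ((int_log hn _).const_mul _)) hiF
      filter_upwards [ae_ne_zero hn] with x hx
      have hx' : 0 < ‖x‖ := norm_pos_iff.2 hx
      have h6 := Real.add_one_le_exp (Real.log ‖x‖ * (-(2 * α)))
      rw [← Real.rpow_def_of_pos hx'] at h6
      have h7 : 0 ≤ ‖(𝓕 g) x‖ ^ 2 := sq_nonneg _
      simp only [Pi.sub_apply]
      nlinarith [mul_le_mul_of_nonneg_right h6 h7]
    linarith
  have hlim := hφ.tendsto_slope_zero_right
  have hge : 0 ≤ (2 * Real.log π - 2 * (deriv Real.Gamma k / Real.Gamma k)) * N + 2 * Lg + 2 * LF := by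
    refine ge_of_tendsto hlim ?_
    filter_upwards [Ioo_mem_nhdsGT (show (0:ℝ) < 1 / 8 by norm_num)] with α hα
    have := hineq α hα.1 hα.2
    simp only [zero_add, hM0, hK0, smul_eq_mul]
    have h8 : 0 ≤ α⁻¹ := inv_nonneg.2 hα.1.le
    apply mul_nonneg h8
    linarith
  linarith

lemma fourierTr_eq {n : ℕ} (f : 𝓢(EuclideanSpace ℝ (Fin n), ℂ)) (ξ : EuclideanSpace ℝ (Fin n)) :
    fourierTr (⇑f) ξ = (((2 * π) ^ (-(n : ℝ) / 2) : ℝ) : ℂ) * (𝓕 f) ((2 * π)⁻¹ • ξ) := by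
  rw [fourierTr, SchwartzMap.fourier_coe, Real.fourier_eq']
  congr 2
  ext x
  rw [smul_eq_mul, real_inner_smul_right]
  congr 2
  have h : -2 * π * ((2 * π)⁻¹ * ⟪x, ξ⟫) = -⟪x, ξ⟫ := by field_simp
  rw [h]
  push_cast
  ring

lemma normSq_fourierTr {n : ℕ} (f : 𝓢(EuclideanSpace ℝ (Fin n), ℂ)) (ξ : EuclideanSpace ℝ (Fin n)) :
    ‖fourierTr (⇑f) ξ‖ ^ 2 = ((2 * π) ^ n)⁻¹ * ‖(𝓕 f) ((2 * π)⁻¹ • ξ)‖ ^ 2 := by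
  have h2 : (0:ℝ) < 2 * π := by positivity
  have e : ((2 * π) ^ (-(n : ℝ) / 2)) ^ 2 = ((2 * π) ^ n)⁻¹ := by
    rw [← Real.rpow_natCast (2 * π) n, ← Real.rpow_neg h2.le, ← Real.rpow_natCast _ 2,
      ← Real.rpow_mul h2.le]
    congr 1
    push_cast
    ring
  rw [fourierTr_eq, norm_mul, mul_pow, Complex.norm_real,
    Real.norm_of_nonneg (Real.rpow_nonneg h2.le _), e]

lemma log_fourierTr {n : ℕ} (hn : 1 ≤ n) (f : 𝓢(EuclideanSpace ℝ (Fin n), ℂ)) :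
    ∫ ξ : EuclideanSpace ℝ (Fin n), Real.log ‖ξ‖ * ‖fourierTr (⇑f) ξ‖ ^ 2 =
    (∫ ξ : EuclideanSpace ℝ (Fin n), Real.log ‖ξ‖ * ‖(𝓕 f) ξ‖ ^ 2) +
      Real.log (2 * π) * ∫ x : EuclideanSpace ℝ (Fin n), ‖f x‖ ^ 2 := by
  have h2 : (0:ℝ) < 2 * π := by positivity
  have h := Measure.integral_comp_inv_smul (volume : Measure (EuclideanSpace ℝ (Fin n)))
    (fun ξ => ((2 * π) ^ n)⁻¹ * ((Real.log ‖ξ‖ + Real.log (2 * π)) * ‖(𝓕 f) ξ‖ ^ 2)) (2 * π)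
  have h0 : ∫ ξ : EuclideanSpace ℝ (Fin n),
      ((2 * π) ^ n)⁻¹ * ((Real.log ‖ξ‖ + Real.log (2 * π)) * ‖(𝓕 f) ξ‖ ^ 2) = ((2 * π) ^ n)⁻¹ *
        ∫ ξ : EuclideanSpace ℝ (Fin n), (Real.log ‖ξ‖ + Real.log (2 * π)) * ‖(𝓕 f) ξ‖ ^ 2 :=
    integral_const_mul _ _
  rw [h0, finrank_euclideanSpace_fin, abs_of_pos (by positivity), smul_eq_mul,
    mul_inv_cancel_left₀ (by positivity)] at h
  rw [← SchwartzMap.integral_norm_sq_fourier f, ← integral_const_mul,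
    ← integral_add (int_log hn _) ((int_sq _).const_mul _)]
  simp_rw [← add_mul]
  rw [← h]
  apply integral_congr_ae
  filter_upwards [ae_ne_zero hn] with ξ hξ
  rw [normSq_fourierTr, norm_smul, Real.norm_of_nonneg (inv_pos.2 h2).le,
    Real.log_mul (inv_pos.2 h2).ne' (norm_ne_zero_iff.2 hξ), Real.log_inv]
  ring

lemma adm' {n : ℕ} (ψ : 𝓢(EuclideanSpace ℝ (Fin n), ℂ)) (C : ℝ)
    (hadm : ∀ ξ : EuclideanSpace ℝ (Fin n), ξ ≠ 0 →
      ∫ a in Set.Ioi (0 : ℝ), ‖fourierTr (⇑ψ) (a • ξ)‖ ^ 2 / a = C)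
    (ξ : EuclideanSpace ℝ (Fin n)) (hξ : ξ ≠ 0) :
    ∫ a in Set.Ioi (0 : ℝ), ‖(𝓕 ψ) (a • ξ)‖ ^ 2 / a = (2 * π) ^ n * C := by
  have h2 : (0:ℝ) < 2 * π := by positivity
  rw [← hadm ((2 * π) • ξ) (smul_ne_zero h2.ne' hξ), ← integral_const_mul]
  congr 1
  ext a
  rw [normSq_fourierTr, smul_comm a, inv_smul_smul₀ h2.ne']
  field_simp

open scoped Convolution in
lemma cwt_schwartz {n : ℕ} (ψ f : 𝓢(EuclideanSpace ℝ (Fin n), ℂ)) {a : ℝ} (ha : 0 < a) :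
    ∃ g : 𝓢(EuclideanSpace ℝ (Fin n), ℂ), (∀ b, g b = CWT (⇑ψ) (⇑f) a b) ∧
      ∀ ξ, ‖(𝓕 g) ξ‖ ^ 2 = a ^ n * (‖(𝓕 ψ) (a • ξ)‖ ^ 2 * ‖(𝓕 f) ξ‖ ^ 2) := by
  have ha' : -a⁻¹ ≠ 0 := neg_ne_zero.2 (inv_ne_zero ha.ne')
  let L : EuclideanSpace ℝ (Fin n) ≃L[ℝ] EuclideanSpace ℝ (Fin n) :=
    ContinuousLinearEquiv.smulLeft (Units.mk0 (-a⁻¹) ha')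
  let φ : 𝓢(EuclideanSpace ℝ (Fin n), ℂ) := (a ^ (-(n:ℝ) / 2)) •
    SchwartzMap.compCLMOfContinuousLinearEquiv ℝ L
      (SchwartzMap.postcompCLM (𝕜 := ℝ) (Complex.conjCLE : ℂ →L[ℝ] ℂ) ψ)
  have hφ : ∀ y, φ y = ((a ^ (-(n:ℝ) / 2) : ℝ) : ℂ) * (starRingEnd ℂ) (ψ (-a⁻¹ • y)) := fun y => rfl
  refine ⟨SchwartzMap.convolution (ContinuousLinearMap.mul ℂ ℂ) φ f, fun b => ?_, fun ξ => ?_⟩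
  · rw [SchwartzMap.convolution_apply, ← MeasureTheory.convolution_flip, MeasureTheory.convolution_def, CWT]
    congr 1
    ext x
    simp only [ContinuousLinearMap.flip_apply, ContinuousLinearMap.mul_apply', hφ, waveletCopy, map_mul, Complex.conj_ofReal]
    rw [show -a⁻¹ • (b - x) = a⁻¹ • (x - b) by module]
  · have hF : (𝓕 φ) ξ = ((a ^ ((n:ℝ) / 2) : ℝ) : ℂ) * (starRingEnd ℂ) ((𝓕 ψ) (a • ξ)) := by
      rw [SchwartzMap.fourier_coe, Real.fourier_eq', SchwartzMap.fourier_coe, Real.fourier_eq', ← integral_conj]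
      have h := Measure.integral_comp_smul (volume : Measure (EuclideanSpace ℝ (Fin n)))
        (fun v => (((a ^ (-(n:ℝ) / 2) : ℝ) : ℂ) * (starRingEnd ℂ) 
          (Complex.exp (((-2 * π * ⟪v, a • ξ⟫ : ℝ) : ℂ) * Complex.I) • ψ v))) (-a⁻¹)
      rw [finrank_euclideanSpace_fin] at h
      have e : |((-a⁻¹) ^ n)⁻¹| = a ^ n := by
        rw [abs_inv, abs_pow, abs_neg, abs_of_pos (inv_pos.2 ha)]; simp
      rw [e] at h
      have e2 : ((a ^ ((n:ℝ) / 2) : ℝ) : ℂ) = ((a ^ n : ℝ) : ℂ) * ((a ^ (-(n:ℝ) / 2) : ℝ) : ℂ) := by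
        rw [← Complex.ofReal_mul, ← Real.rpow_natCast, ← Real.rpow_add ha]
        congr 2
        ring
      rw [e2, mul_assoc, ← Complex.real_smul, ← integral_const_mul, ← h]
      congr 1
      ext v
      rw [hφ, smul_eq_mul, smul_eq_mul, map_mul, ← Complex.exp_conj, map_mul, Complex.conj_I,
        Complex.conj_ofReal, real_inner_smul_left, real_inner_smul_right]
      have e3 : -2 * π * (-a⁻¹ * (a * ⟪v, ξ⟫)) = - (-2 * π * ⟪v, ξ⟫) := by field_simp
      rw [e3]
      push_cast
      ring_nf
    rw [SchwartzMap.fourier_convolution, SchwartzMap.pairing_apply_apply, ContinuousLinearMap.mul_apply',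
      hF, norm_mul, norm_mul, mul_pow, mul_pow, Complex.norm_real, RCLike.norm_conj,
      Real.norm_of_nonneg (by positivity), ← Real.rpow_natCast (a ^ _), ← Real.rpow_mul ha.le]
    rw [show ((n:ℝ) / 2 * (2:ℕ)) = (n:ℝ) by push_cast; ring, Real.rpow_natCast, mul_assoc]

lemma cwt_measurable {n : ℕ} (ψ f : 𝓢(EuclideanSpace ℝ (Fin n), ℂ)) :
    StronglyMeasurable (fun p : ℝ × EuclideanSpace ℝ (Fin n) => CWT (⇑ψ) (⇑f) p.1 p.2) := by
  have hψ : Measurable (ψ : EuclideanSpace ℝ (Fin n) → ℂ) := ψ.continuous.measurable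
  have hf : Measurable (f : EuclideanSpace ℝ (Fin n) → ℂ) := f.continuous.measurable
  unfold CWT waveletCopy
  refine StronglyMeasurable.integral_prod_right (f := fun (p : ℝ × EuclideanSpace ℝ (Fin n))
    (x : EuclideanSpace ℝ (Fin n)) => (starRingEnd ℂ) (((p.1 ^ (-(n : ℝ) / 2) : ℝ) : ℂ) *
      ψ (p.1⁻¹ • (x - p.2))) * f x) (Measurable.stronglyMeasurable ?_)
  simp only [Function.uncurry_def]
  refine Measurable.mul (Complex.continuous_conj.measurable.comp (Measurable.mul ?_ ?_)) ?_
  · fun_prop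
  · fun_prop
  · fun_prop

lemma fubini_adm {n : ℕ} (hn : 1 ≤ n) (ψ : 𝓢(EuclideanSpace ℝ (Fin n), ℂ)) (D : ℝ) (hD : 0 < D)
    (h : ∀ ξ : EuclideanSpace ℝ (Fin n), ξ ≠ 0 →
      ∫ a in Set.Ioi (0 : ℝ), ‖(𝓕 ψ) (a • ξ)‖ ^ 2 / a = D)
    {u : EuclideanSpace ℝ (Fin n) → ℝ} (hu : Integrable u) :
    Integrable (fun a : ℝ => ∫ ξ, u ξ * (‖(𝓕 ψ) (a • ξ)‖ ^ 2 / a)) (volume.restrict (Set.Ioi 0)) ∧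
    ∫ a in Set.Ioi (0 : ℝ), ∫ ξ, u ξ * (‖(𝓕 ψ) (a • ξ)‖ ^ 2 / a) = D * ∫ ξ, u ξ := by
  have hψ : Measurable (fun x => (𝓕 ψ) x) := (𝓕 ψ).continuous.measurable
  have hm : Measurable (fun p : ℝ × EuclideanSpace ℝ (Fin n) => ‖(𝓕 ψ) (p.1 • p.2)‖ ^ 2 / p.1) := by
    fun_prop
  have hF : Integrable (fun p : ℝ × EuclideanSpace ℝ (Fin n) =>
      u p.2 * (‖(𝓕 ψ) (p.1 • p.2)‖ ^ 2 / p.1)) ((volume.restrict (Set.Ioi 0)).prod volume) := by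
    refine (integrable_prod_iff' (hu.1.comp_snd.mul hm.aestronglyMeasurable)).2 ⟨?_, ?_⟩
    · filter_upwards [ae_ne_zero hn] with ξ hξ
      have hw : Integrable (fun a : ℝ => ‖(𝓕 ψ) (a • ξ)‖ ^ 2 / a) (volume.restrict (Set.Ioi 0)) := by
        apply Integrable.of_integral_ne_zero
        rw [h ξ hξ]
        exact hD.ne'
      exact hw.const_mul (u ξ)
    · refine (hu.norm.const_mul D).congr ?_
      filter_upwards [ae_ne_zero hn] with ξ hξ
      rw [← h ξ hξ, mul_comm, ← integral_const_mul]
      apply setIntegral_congr_fun measurableSet_Ioi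
      intro a ha
      have ha' : (0:ℝ) < a := ha
      simp only [Pi.mul_apply]
      rw [norm_mul, Real.norm_of_nonneg (r := _ / _) (by positivity)]
  refine ⟨hF.integral_prod_left, ?_⟩
  have hsw : ∫ a in Set.Ioi (0 : ℝ), ∫ ξ, u ξ * (‖(𝓕 ψ) (a • ξ)‖ ^ 2 / a) =
      ∫ ξ, ∫ a in Set.Ioi (0 : ℝ), u ξ * (‖(𝓕 ψ) (a • ξ)‖ ^ 2 / a) :=
    integral_integral_swap hF
  rw [hsw, ← integral_const_mul]
  apply integral_congr_ae
  filter_upwards [ae_ne_zero hn] with ξ hξ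
  rw [integral_const_mul, h ξ hξ, mul_comm]

lemma integrable_left {n : ℕ} (ψ f : 𝓢(EuclideanSpace ℝ (Fin n), ℂ))
    (hlog : ∫⁻ a in Set.Ioi (0 : ℝ),
        (∫⁻ b : EuclideanSpace ℝ (Fin n),
          ENNReal.ofReal (|Real.log ‖b‖| * ‖CWT (⇑ψ) (⇑f) a b‖ ^ 2)) /
            ENNReal.ofReal (a ^ (n + 1)) < ∞) :
    Integrable (fun a : ℝ => (∫ b : EuclideanSpace ℝ (Fin n),
          Real.log ‖b‖ * ‖CWT (⇑ψ) (⇑f) a b‖ ^ 2) / a ^ (n + 1)) (volume.restrict (Set.Ioi 0)) := by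
  have hm := (cwt_measurable ψ f).measurable
  have h1 : StronglyMeasurable (fun a : ℝ => ∫ b : EuclideanSpace ℝ (Fin n),
      Real.log ‖b‖ * ‖CWT (⇑ψ) (⇑f) a b‖ ^ 2) := by
    refine StronglyMeasurable.integral_prod_right (f := fun (a : ℝ) (b : EuclideanSpace ℝ (Fin n)) =>
      Real.log ‖b‖ * ‖CWT (⇑ψ) (⇑f) a b‖ ^ 2) (Measurable.stronglyMeasurable ?_)
    simp only [Function.uncurry_def]
    fun_prop
  have h2 : Measurable (fun a : ℝ => (∫ b : EuclideanSpace ℝ (Fin n),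
          Real.log ‖b‖ * ‖CWT (⇑ψ) (⇑f) a b‖ ^ 2) / a ^ (n + 1)) := by
    have := h1.measurable
    fun_prop
  refine ⟨h2.aestronglyMeasurable, lt_of_le_of_lt (setLIntegral_mono' measurableSet_Ioi ?_) hlog⟩
  intro a ha
  have ha' : (0:ℝ) < a := ha
  rw [← ofReal_norm, norm_div, Real.norm_of_nonneg (r := a ^ _) (by positivity),
    ENNReal.ofReal_div_of_pos (by positivity)]
  gcongr
  rw [ofReal_norm]
  refine (enorm_integral_le_lintegral_enorm _).trans (lintegral_mono fun b => ?_)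
  rw [← ofReal_norm, norm_mul, Real.norm_eq_abs, Real.norm_of_nonneg (sq_nonneg _)]

/-- Logarithmic uncertainty principle for the continuous wavelet transform. -/
theorem log_uncertainty_wavelet {n : ℕ} (hn : 1 ≤ n)
    (ψ : SchwartzMap (EuclideanSpace ℝ (Fin n)) ℂ)
    (C : ℝ) (hC : 0 < C)
    (hadm : ∀ ξ : EuclideanSpace ℝ (Fin n), ξ ≠ 0 →
      ∫ a in Set.Ioi (0 : ℝ), ‖fourierTr (⇑ψ) (a • ξ)‖ ^ 2 / a = C)
    (f : SchwartzMap (EuclideanSpace ℝ (Fin n)) ℂ)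
    (hlog : ∫⁻ a in Set.Ioi (0 : ℝ),
        (∫⁻ b : EuclideanSpace ℝ (Fin n),
          ENNReal.ofReal (|Real.log ‖b‖| * ‖CWT (⇑ψ) (⇑f) a b‖ ^ 2)) /
            ENNReal.ofReal (a ^ (n + 1)) < ∞) :
    (∫ a in Set.Ioi (0 : ℝ),
        (∫ b : EuclideanSpace ℝ (Fin n),
          Real.log ‖b‖ * ‖CWT (⇑ψ) (⇑f) a b‖ ^ 2) / a ^ (n + 1)) +
      (2 * π) ^ n * C *
        (∫ ξ : EuclideanSpace ℝ (Fin n), Real.log ‖ξ‖ * ‖fourierTr (⇑f) ξ‖ ^ 2) ≥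
    (deriv Real.Gamma ((n : ℝ) / 4) / Real.Gamma ((n : ℝ) / 4) + Real.log 2) *
      ((2 * π) ^ n * C) * ∫ x : EuclideanSpace ℝ (Fin n), ‖f x‖ ^ 2 := by
  have hD : 0 < (2 * π) ^ n * C := by positivity
  have hadm' := adm' ψ C hadm
  obtain ⟨hN, hN'⟩ := fubini_adm hn ψ _ hD hadm' (int_sq (𝓕 f))
  obtain ⟨hJ, hJ'⟩ := fubini_adm hn ψ _ hD hadm' (int_log hn (𝓕 f))
  have hI := integrable_left ψ f hlog
  have key := setIntegral_mono_on
    (hN.const_mul (deriv Real.Gamma ((n : ℝ) / 4) / Real.Gamma ((n : ℝ) / 4) - Real.log π))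
    (hI.add hJ) measurableSet_Ioi (by
      intro a ha
      have ha' : (0:ℝ) < a := ha
      obtain ⟨g, hg, hFg⟩ := cwt_schwartz ψ f ha'
      have hb := beckner hn g
      rw [← SchwartzMap.integral_norm_sq_fourier g] at hb
      simp_rw [hFg, hg] at hb
      have e1 : ∫ ξ, ‖(𝓕 f) ξ‖ ^ 2 * (‖(𝓕 ψ) (a • ξ)‖ ^ 2 / a) =
          (∫ ξ, a ^ n * (‖(𝓕 ψ) (a • ξ)‖ ^ 2 * ‖(𝓕 f) ξ‖ ^ 2)) / a ^ (n + 1) := by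
        rw [← integral_div]
        congr 1
        ext ξ
        field_simp
        ring
      have e2 : ∫ ξ, Real.log ‖ξ‖ * ‖(𝓕 f) ξ‖ ^ 2 * (‖(𝓕 ψ) (a • ξ)‖ ^ 2 / a) =
          (∫ ξ, Real.log ‖ξ‖ * (a ^ n * (‖(𝓕 ψ) (a • ξ)‖ ^ 2 * ‖(𝓕 f) ξ‖ ^ 2))) / a ^ (n + 1) := by
        rw [← integral_div]
        congr 1
        ext ξ
        field_simp
        ring
      simp only [Pi.add_apply]
      rw [e1, e2, ← add_div, ← mul_div_assoc]
      gcongr)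
  rw [integral_const_mul, hN'] at key
  simp only [Pi.add_apply] at key
  rw [integral_add hI hJ, hJ', SchwartzMap.integral_norm_sq_fourier f] at key
  rw [log_fourierTr hn, Real.log_mul two_ne_zero pi_ne_zero]
  nlinarith [key]
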